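/- Let P be a finite poset on [n] (i ≺ j implies i < j) and G the directed graph on [n] with i → j iff i < j and i ⊀ j. For 1 ≤ i_1 < ... < i_ν ≤ n, let d(i_1,...,i_ν) be the number of directed paths from i_1 to i_ν in G restricted to {i_1,...,i_ν}. Solving the recursion w_i = t x_i Σ_{i<j, i⊀j} ( w_j + t x_j - t x_j Σ_{r>j} w_r ) Π_{r=i+1}^{j-1} (1 + t x_r) with w_n = 0, one obtains 1 - Σ_i w_i = 1 + Σ_{1≤i_1<...<i_ν≤n, ν≥2} c(i_1,...,i_ν) t^ν x_{i_1} ⋯ x_{i_ν}, where c(i_1,...,i_ν) = Σ_{0=a_0<a_1<...<a_r=ν, a_{s+1}-a_s≥2, r≥1} (-1)^r d(i_{a_0+1},...,i_{a_1}) ⋯ d(i_{a_{r-1}+1},...,i_{a_r}). -/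

import Mathlib

/-!
STATEMENT 17: Solving the recursion `w_i = t x_i Σ_{i<j, i⊀j} (w_j + t x_j
 - t x_j Σ_{r>j} w_r) Π_{r=i+1}^{j-1} (1 + t x_r)` (with `w_n = 0`) yields
`1 - Σ_i w_i = 1 + Σ_{i_1<…<i_ν, ν≥2} c(i_1,…,i_ν) t^ν x_{i_1}⋯x_{i_ν}`,
where `c(i_1,…,i_ν) = Σ (-1)^r d(block_1)⋯d(block_r)` over all partitions of
`i_1<…<i_ν` into consecutive blocks of size ≥ 2, and `d` counts directed paths
from the smallest to the largest vertex of a block inside that block, in the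
graph with `a → b` iff `a < b` and `a ⊀ b`.
-/

open scoped Classical

noncomputable section

variable {n : ℕ}

/-- The number of directed paths from the first to the last entry of the
(increasing) list `L`, using only vertices of `L`, in the graph with
`a → b` iff `a < b` and `a ⊀ b`. -/
def dpaths (pre : Fin n → Fin n → Prop) (L : List (Fin n)) : ℤ :=
  (Nat.card {p : List (Fin n) // p ≠ [] ∧ p.head? = L.head? ∧ p.getLast? = L.getLast? ∧
    (∀ x ∈ p, x ∈ L) ∧ p.Chain' (fun u w => u < w ∧ ¬ pre u w)} : ℤ)

/-- `blockSum d L = Σ (-1)^r d(B_1)⋯d(B_r)` over all ordered partitions of the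
list `L` into consecutive blocks `B_1,…,B_r` each of length ≥ 2 (with value `1`
for the empty list, corresponding to the empty partition).  For nonempty `L`
this is the coefficient `c(i_1,…,i_ν)`. -/
def blockSum (d : List (Fin n) → ℤ) : List (Fin n) → ℤ
  | [] => 1
  | a :: L => - ∑ s ∈ (Finset.Icc 2 (a :: L).length).attach,
      d ((a :: L).take s.1) * blockSum d ((a :: L).drop s.1)
  termination_by L => L.length
  decreasing_by
    have hs := (Finset.mem_Icc.mp s.2).1
    simp only [List.length_drop]
    simp only [List.length_cons]
    omega

/-- The directed paths along `R` from the first to the last entry of `L`, with vertices in `L`. -/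
def pathSet {α : Type*} (R : α → α → Prop) (L : List α) : Set (List α) :=
  {p | p ≠ [] ∧ p.head? = L.head? ∧ p.getLast? = L.getLast? ∧ (∀ x ∈ p, x ∈ L) ∧ p.IsChain R}

/-- The nonempty lists `q` with vertices in `L` ending at the last entry of `L` such that
`a :: q` is a directed path along `R`. -/
def pathTails {α : Type*} (R : α → α → Prop) (a : α) (L : List α) : Set (List α) :=
  {q | q ≠ [] ∧ q.getLast? = L.getLast? ∧ (∀ x ∈ q, x ∈ L) ∧ (a :: q).IsChain R}

theorem pathTails_nil {α : Type*} {R : α → α → Prop} (a : α) :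
    pathTails R a [] = ∅ := by
  ext q
  simp +contextual [pathTails]

section Paths

variable {α : Type*} [LinearOrder α] {R : α → α → Prop}

theorem pairwise_lt_of_isChain (hR : ∀ a b, R a b → a < b) {p : List α} (hp : p.IsChain R) :
    p.Pairwise (· < ·) :=
  List.isChain_iff_pairwise.mp (hp.imp hR)

theorem finite_setOf_isChain [Fintype α] (hR : ∀ a b, R a b → a < b) :
    {p : List α | p.IsChain R}.Finite := by
  refine (List.finite_length_le α (Fintype.card α)).subset fun p hp => ?_
  exact List.Nodup.length_le_card ((pairwise_lt_of_isChain hR hp).imp ne_of_lt)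

theorem pathSet_singleton (hR : ∀ a b, R a b → a < b) (a : α) : pathSet R [a] = {[a]} := by
  ext p
  simp only [pathSet, Set.mem_ofPred_eq, Set.mem_singleton_iff]
  constructor
  · rintro ⟨hne, -, -, hmem, hch⟩
    have hlt := pairwise_lt_of_isChain hR hch
    match p, hne with
    | [x], _ => simpa using hmem
    | x :: z :: p, _ =>
      have hx := hmem x (by simp)
      have hz := hmem z (by simp)
      simp only [List.mem_singleton] at hx hz
      simp [hx, hz] at hlt
  · rintro rfl
    simp

theorem pathSet_cons (hR : ∀ a b, R a b → a < b) {a : α} {L : List α} (hL : L ≠ [])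
    (hs : (a :: L).Pairwise (· < ·)) :
    pathSet R (a :: L) = List.cons a '' pathTails R a L := by
  have haL : ∀ x ∈ L, a < x := (List.pairwise_cons.mp hs).1
  have hlast : ∃ z ∈ L, L.getLast? = some z :=
    ⟨L.getLast hL, L.getLast_mem hL, List.getLast?_eq_some_getLast hL⟩
  obtain ⟨z, hzL, hz⟩ := hlast
  ext p
  simp only [pathSet, pathTails, Set.mem_ofPred_eq, Set.mem_image]
  constructor
  · rintro ⟨hne, hhead, hla, hmem, hch⟩
    match p, hne with
    | x :: q, _ =>
      obtain rfl : x = a := by simpa using hhead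
      have hlt := List.pairwise_cons.mp (pairwise_lt_of_isChain hR hch)
      refine ⟨q, ⟨?_, ?_, ?_, hch⟩, rfl⟩
      · rintro rfl
        have := haL z hzL
        simp [List.getLast?_cons, hz] at hla
        exact this.ne hla
      · rw [hz]
        rw [List.getLast?_cons, List.getLast?_cons, hz] at hla
        cases hq : q.getLast? with
        | none =>
          have := haL z hzL
          simp [hq] at hla
          exact absurd hla this.ne
        | some u => simpa [hq] using hla
      · intro u hu
        exact (List.mem_cons.mp (hmem u (List.mem_cons_of_mem _ hu))).resolve_left (hlt.1 u hu).ne'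
  · rintro ⟨q, ⟨hne, hla, hmem, hch⟩, rfl⟩
    refine ⟨by simp, by simp, ?_, ?_, hch⟩
    · rw [List.getLast?_cons, List.getLast?_cons, hla]
    · intro u hu
      rcases List.mem_cons.mp hu with rfl | hu
      · simp
      · exact List.mem_cons_of_mem _ (hmem u hu)

theorem pathTails_cons (hR : ∀ a b, R a b → a < b) (a : α) {b : α} {L : List α}
    (hs : (b :: L).Pairwise (· < ·)) :
    pathTails R a (b :: L) = {q | R a b ∧ q ∈ pathSet R (b :: L)} ∪ pathTails R a L := by
  have hbL : ∀ x ∈ L, b < x := (List.pairwise_cons.mp hs).1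
  ext q
  simp only [pathSet, pathTails, Set.mem_ofPred_eq, Set.mem_union]
  constructor
  · rintro ⟨hne, hla, hmem, hch⟩
    match q, hne with
    | x :: q, _ =>
      rw [List.isChain_cons_cons] at hch
      by_cases hx : x = b
      · subst hx
        exact Or.inl ⟨hch.1, by simp, by simp, hla, hmem, hch.2⟩
      · have hxL : x ∈ L := (List.mem_cons.mp (hmem x (by simp))).resolve_left hx
        have hlt := List.pairwise_cons.mp (pairwise_lt_of_isChain hR hch.2)
        refine Or.inr ⟨by simp, ?_, ?_, List.isChain_cons_cons.mpr hch⟩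
        · rw [hla]
          cases L with
          | nil => simp at hxL
          | cons c L => simp
        · intro u hu
          rcases List.mem_cons.mp hu with rfl | hu'
          · exact hxL
          · exact (List.mem_cons.mp (hmem u hu)).resolve_left
              ((hbL x hxL).trans (hlt.1 u hu')).ne'
  · rintro (⟨hab, hne, hhead, hla, hmem, hch⟩ | ⟨hne, hla, hmem, hch⟩)
    · match q, hne with
      | x :: q, _ =>
        obtain rfl : x = b := by simpa using hhead
        exact ⟨by simp, hla, hmem, List.isChain_cons_cons.mpr ⟨hab, hch⟩⟩
    · refine ⟨hne, ?_, fun u hu => List.mem_cons_of_mem _ (hmem u hu), hch⟩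
      rw [hla]
      cases L with
      | nil => cases q <;> simp_all
      | cons c L => simp

theorem ncard_pathSet_cons (hR : ∀ a b, R a b → a < b) {a : α} {L : List α} (hL : L ≠ [])
    (hs : (a :: L).Pairwise (· < ·)) :
    (pathSet R (a :: L)).ncard = (pathTails R a L).ncard := by
  rw [pathSet_cons hR hL hs, Set.ncard_image_of_injective _ List.cons_injective]

theorem ncard_pathTails_cons [Fintype α] (hR : ∀ a b, R a b → a < b) (a : α) {b : α}
    {L : List α} (hs : (b :: L).Pairwise (· < ·)) :
    (pathTails R a (b :: L)).ncard =
      (if R a b then (pathSet R (b :: L)).ncard else 0) + (pathTails R a L).ncard := by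
  have hset : (pathSet R (b :: L)).Finite :=
    (finite_setOf_isChain hR).subset fun p hp => hp.2.2.2.2
  have htails : (pathTails R a L).Finite :=
    (finite_setOf_isChain hR).subset fun p hp => hp.2.2.2.tail
  have hdisj : Disjoint {q | R a b ∧ q ∈ pathSet R (b :: L)} (pathTails R a L) := by
    rw [Set.disjoint_left]
    rintro q ⟨-, hne, hhead, -⟩ ⟨-, -, hmem, -⟩
    have hb : b ∈ q := List.mem_of_head? (by simpa using hhead)
    exact lt_irrefl b ((List.pairwise_cons.mp hs).1 b (hmem b hb))
  rw [pathTails_cons hR a hs,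
    Set.ncard_union_eq hdisj (hset.subset fun q hq => hq.2) htails]
  split_ifs with h <;> simp [h]

end Paths

theorem blockSum_cons (d : List (Fin n) → ℤ) (a : Fin n) (L : List (Fin n)) :
    blockSum d (a :: L) =
      -∑ k ∈ Finset.range L.length, d (a :: L.take (k + 1)) * blockSum d (L.drop (k + 1)) := by
  rw [blockSum,
    Finset.sum_attach _ fun s => d ((a :: L).take s) * blockSum d ((a :: L).drop s),
    Finset.range_eq_Ico]
  have hIcc : Finset.Icc 2 (a :: L).length = Finset.Ico (0 + 2) (L.length + 2) := by
    ext k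
    simp only [Finset.mem_Icc, Finset.mem_Ico, List.length_cons]
    omega
  rw [hIcc, ← Finset.sum_Ico_add']
  simp

/-- The sum over the splittings of `L` into a nonempty initial segment `S` and a rest `T` of the
number of paths from `a` through `S` to its last entry, times the block sum of `T`. -/
def tailSum (R : Fin n → Fin n → Prop) (d : List (Fin n) → ℤ) (a : Fin n)
    (L : List (Fin n)) : ℤ :=
  ∑ k ∈ Finset.range L.length,
    ((pathTails R a (L.take (k + 1))).ncard : ℤ) * blockSum d (L.drop (k + 1))

section TailSum

variable {R : Fin n → Fin n → Prop} {d : List (Fin n) → ℤ}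

theorem tailSum_nil (a : Fin n) : tailSum R d a [] = 0 := by
  simp [tailSum]

theorem blockSum_cons_eq_neg_tailSum (hR : ∀ a b, R a b → a < b)
    (hd : ∀ L, d L = (pathSet R L).ncard) {a : Fin n} {L : List (Fin n)}
    (hs : (a :: L).Pairwise (· < ·)) :
    blockSum d (a :: L) = -tailSum R d a L := by
  rw [blockSum_cons, tailSum]
  refine congrArg _ (Finset.sum_congr rfl fun k hk => ?_)
  have hne : L.take (k + 1) ≠ [] := by
    rintro h
    simp_all
  rw [hd, ncard_pathSet_cons hR hne (hs.sublist ((List.take_sublist _ _).cons_cons a))]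

theorem tailSum_cons (hR : ∀ a b, R a b → a < b) (a : Fin n) {c : Fin n} {L : List (Fin n)}
    (hs : (c :: L).Pairwise (· < ·)) :
    tailSum R d a (c :: L) =
      (if R a c then blockSum d L + tailSum R d c L else 0) + tailSum R d a L := by
  have hsub (k : ℕ) : (c :: L.take k).Pairwise (· < ·) :=
    hs.sublist ((List.take_sublist _ _).cons_cons c)
  have hstep : ∀ k ∈ Finset.range L.length,
      ((pathTails R a (c :: L.take (k + 1))).ncard : ℤ) * blockSum d (L.drop (k + 1)) =
        (if R a c then
          ((pathTails R c (L.take (k + 1))).ncard : ℤ) * blockSum d (L.drop (k + 1)) else 0) +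
        ((pathTails R a (L.take (k + 1))).ncard : ℤ) * blockSum d (L.drop (k + 1)) := by
    intro k hk
    have hne : L.take (k + 1) ≠ [] := by
      rintro h
      simp_all
    rw [ncard_pathTails_cons hR a (hsub _), ncard_pathSet_cons hR hne (hsub _)]
    split_ifs <;> push_cast <;> ring
  have hzero : (pathTails R a [c]).ncard = if R a c then 1 else 0 := by
    rw [ncard_pathTails_cons hR a (by simp), pathSet_singleton hR, pathTails_nil]
    simp
  rw [tailSum, List.length_cons, Finset.sum_range_succ']
  simp only [List.take_succ_cons, List.drop_succ_cons, List.take_zero, List.drop_zero, hzero]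
  rw [Finset.sum_congr rfl hstep, Finset.sum_add_distrib, tailSum, tailSum]
  split_ifs
  · push_cast
    ring
  · simp

end TailSum

section Weighted

variable {K : Type*} [CommRing K]

/-- The sum of `f` over the subsets `s` of `A`, listed increasingly, weighted by `∏ i ∈ s, y i`. -/
def weightedSum (y : Fin n → K) (f : List (Fin n) → ℤ) (A : Finset (Fin n)) : K :=
  ∑ s ∈ A.powerset, (f (s.sort (· ≤ ·)) : K) * ∏ i ∈ s, y i

theorem weightedSum_empty (y : Fin n → K) (f : List (Fin n) → ℤ) :
    weightedSum y f ∅ = f [] := by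
  simp [weightedSum]

theorem weightedSum_insert (y : Fin n → K) (f : List (Fin n) → ℤ) {c : Fin n}
    {A : Finset (Fin n)} (hc : ∀ x ∈ A, c < x) :
    weightedSum y f (insert c A) =
      weightedSum y f A + y c * weightedSum y (fun L => f (c :: L)) A := by
  have hcA : c ∉ A := fun h => lt_irrefl c (hc c h)
  rw [weightedSum, Finset.sum_powerset_insert hcA, weightedSum, weightedSum, Finset.mul_sum]
  refine congrArg _ (Finset.sum_congr rfl fun s hs => ?_)
  have hsA := Finset.mem_powerset.mp hs
  have hcs : c ∉ s := fun h => hcA (hsA h)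
  rw [Finset.sort_insert _ (fun b hb => (hc b (hsA hb)).le) hcs, Finset.prod_insert hcs]
  ring

theorem weightedSum_congr (y : Fin n → K) {f g : List (Fin n) → ℤ} {A : Finset (Fin n)}
    (h : ∀ s ⊆ A, f (s.sort (· ≤ ·)) = g (s.sort (· ≤ ·))) :
    weightedSum y f A = weightedSum y g A :=
  Finset.sum_congr rfl fun s hs => by rw [h s (Finset.mem_powerset.mp hs)]

theorem pairwise_cons_sort {c : Fin n} {A s : Finset (Fin n)} (hc : ∀ x ∈ A, c < x)
    (hs : s ⊆ A) : (c :: s.sort (· ≤ ·)).Pairwise (· < ·) :=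
  List.pairwise_cons.mpr
    ⟨fun x hx => hc x (hs ((Finset.mem_sort _).mp hx)), s.sortedLT_sort.pairwise⟩

variable {R : Fin n → Fin n → Prop} {d : List (Fin n) → ℤ}

theorem weightedSum_blockSum_insert (hR : ∀ a b, R a b → a < b)
    (hd : ∀ L, d L = (pathSet R L).ncard) (y : Fin n → K) {c : Fin n} {A : Finset (Fin n)}
    (hc : ∀ x ∈ A, c < x) :
    weightedSum y (blockSum d) (insert c A) =
      weightedSum y (blockSum d) A - y c * weightedSum y (tailSum R d c) A := by
  rw [weightedSum_insert y _ hc, weightedSum_congr y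
    (f := fun L => blockSum d (c :: L)) (g := fun L => -tailSum R d c L)
    fun s hs => blockSum_cons_eq_neg_tailSum hR hd (pairwise_cons_sort hc hs)]
  simp only [weightedSum, Int.cast_neg, neg_mul, Finset.sum_neg_distrib]
  ring

theorem weightedSum_tailSum_insert (hR : ∀ a b, R a b → a < b) (y : Fin n → K) (a : Fin n) {c : Fin n}
    {A : Finset (Fin n)} (hc : ∀ x ∈ A, c < x) :
    weightedSum y (tailSum R d a) (insert c A) =
      (if R a c then y c * (weightedSum y (blockSum d) A + weightedSum y (tailSum R d c) A)
        else 0) + (1 + y c) * weightedSum y (tailSum R d a) A := by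
  rw [weightedSum_insert y _ hc, weightedSum_congr y (f := fun L => tailSum R d a (c :: L))
    (g := fun L => (if R a c then blockSum d L + tailSum R d c L else 0) + tailSum R d a L)
    fun s hs => tailSum_cons hR a (pairwise_cons_sort hc hs)]
  split_ifs
  · simp only [weightedSum, Int.cast_add, add_mul, Finset.sum_add_distrib]
    ring
  · simp only [zero_add]
    ring

/-- The elements of `Fin n` of value at least `m`. -/
def upperFin (n m : ℕ) : Finset (Fin n) := Finset.univ.filter fun j => m ≤ j

theorem mem_upperFin {m : ℕ} {j : Fin n} : j ∈ upperFin n m ↔ m ≤ j := by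
  simp [upperFin]

theorem upperFin_eq_insert (c : Fin n) :
    upperFin n c = insert c (upperFin n (c + 1)) := by
  ext j
  simp only [mem_upperFin, Finset.mem_insert, Fin.ext_iff]
  omega

theorem lt_of_mem_upperFin_succ {c : Fin n} : ∀ x ∈ upperFin n (c + 1), c < x :=
  fun _ hx => mem_upperFin.mp hx

theorem weightedSum_upperFin (hR : ∀ a b, R a b → a < b)
    (hd : ∀ L, d L = (pathSet R L).ncard) (y w : Fin n → K)
    (hw : ∀ i, w i = y i * ∑ j ∈ Finset.univ.filter (R i),
      (w j + y j - y j * ∑ r ∈ Finset.Ioi j, w r) * ∏ r ∈ Finset.Ioo i j, (1 + y r))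
    {m : ℕ} (hm : m ≤ n) :
    weightedSum y (blockSum d) (upperFin n m) = 1 - ∑ r ∈ upperFin n m, w r ∧
    ∀ a, weightedSum y (tailSum R d a) (upperFin n m) =
      ∑ j ∈ (upperFin n m).filter (R a),
        (w j + y j - y j * ∑ r ∈ Finset.Ioi j, w r) *
          ∏ r ∈ (upperFin n m).filter (· < j), (1 + y r) := by
  induction hm using Nat.decreasingInduction with
  | self =>
    have h : upperFin n n = ∅ := by
      ext j
      simp [mem_upperFin]
    rw [h]
    simp [weightedSum_empty, tailSum_nil, blockSum]
  | of_succ m hm ih =>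
    obtain ⟨c, rfl⟩ : ∃ c : Fin n, (c : ℕ) = m := ⟨⟨m, hm⟩, rfl⟩
    obtain ⟨ihb, iht⟩ := ih
    have hlt := lt_of_mem_upperFin_succ (c := c)
    have hc : c ∉ upperFin n (c + 1) := fun h => lt_irrefl c (hlt c h)
    have hIoi : Finset.Ioi c = upperFin n (c + 1) := by
      ext j
      rw [Finset.mem_Ioi, mem_upperFin]
      exact Iff.rfl
    have hwc : w c = y c * weightedSum y (tailSum R d c) (upperFin n (c + 1)) := by
      rw [hw, iht]
      have hfilter : Finset.univ.filter (R c) = (upperFin n (c + 1)).filter (R c) := by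
        ext j
        simp only [Finset.mem_filter, Finset.mem_univ, true_and, ← hIoi, Finset.mem_Ioi]
        exact ⟨fun h => ⟨hR _ _ h, h⟩, And.right⟩
      rw [hfilter]
      refine congrArg _ (Finset.sum_congr rfl fun j _ => congrArg _ ?_)
      refine Finset.prod_congr ?_ fun _ _ => rfl
      ext r
      simp [← hIoi]
    rw [upperFin_eq_insert]
    refine ⟨?_, fun a => ?_⟩
    · rw [weightedSum_blockSum_insert hR hd y hlt, Finset.sum_insert hc, ← hwc, ihb]
      ring
    · have hrest : ∑ j ∈ (upperFin n (c + 1)).filter (R a),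
          (w j + y j - y j * ∑ r ∈ Finset.Ioi j, w r) *
            ∏ r ∈ (insert c (upperFin n (c + 1))).filter (· < j), (1 + y r) =
          (1 + y c) * weightedSum y (tailSum R d a) (upperFin n (c + 1)) := by
        rw [iht, Finset.mul_sum]
        refine Finset.sum_congr rfl fun j hj => ?_
        rw [Finset.filter_insert, if_pos (hlt j (Finset.mem_filter.mp hj).1),
          Finset.prod_insert (by simp [hc])]
        ring
      have hfirst : (insert c (upperFin n (c + 1))).filter (· < c) = ∅ := by
        ext r
        simp only [Finset.mem_filter, Finset.mem_insert, Finset.notMem_empty, iff_false]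
        rintro ⟨rfl | h, h'⟩
        · exact lt_irrefl _ h'
        · exact lt_asymm h' (hlt r h)
      rw [weightedSum_tailSum_insert hR y a hlt, Finset.filter_insert]
      split_ifs with hac
      · rw [Finset.sum_insert (by simp [hc]), hrest, hfirst, hIoi, ihb, mul_add, ← hwc]
        simp only [Finset.prod_empty]
        ring
      · rw [hrest, zero_add]

theorem weightedSum_blockSum_univ (hR : ∀ a b, R a b → a < b)
    (hd : ∀ L, d L = (pathSet R L).ncard) (y : Fin n → K) :
    weightedSum y (blockSum d) Finset.univ =
      1 + ∑ s ∈ Finset.univ.powerset.filter (fun s : Finset (Fin n) => 2 ≤ s.card),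
        (blockSum d (s.sort (· ≤ ·)) : K) * ∏ i ∈ s, y i := by
  rw [weightedSum, ← Finset.sum_filter_add_sum_filter_not _
    (fun s : Finset (Fin n) => 2 ≤ s.card), add_comm]
  congr 1
  rw [Finset.sum_eq_single ∅]
  · simp [blockSum]
  · intro s hs hne
    have hcard : s.card = 1 := by
      have := (Finset.mem_filter.mp hs).2
      have := Finset.card_pos.mpr (Finset.nonempty_iff_ne_empty.mpr hne)
      omega
    obtain ⟨a, rfl⟩ := Finset.card_eq_one.mp hcard
    rw [Finset.sort_singleton, blockSum_cons_eq_neg_tailSum hR hd (by simp), tailSum_nil]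
    simp
  · simp

end Weighted

theorem one_sub_sum_w_eq
    (pre : Fin n → Fin n → Prop) [IsStrictOrder (Fin n) pre]
    (hcomp : ∀ a b, pre a b → a < b)
    (w : Fin n → MvPolynomial (Fin n ⊕ Unit) ℚ)
    (hw : ∀ i, w i =
      MvPolynomial.X (Sum.inr ()) * MvPolynomial.X (Sum.inl i) *
      ∑ j ∈ Finset.univ.filter (fun j => i < j ∧ ¬ pre i j),
        (w j + MvPolynomial.X (Sum.inr ()) * MvPolynomial.X (Sum.inl j)
           - MvPolynomial.X (Sum.inr ()) * MvPolynomial.X (Sum.inl j) *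
               ∑ r ∈ Finset.Ioi j, w r) *
          ∏ r ∈ Finset.Ioo i j,
            (1 + MvPolynomial.X (Sum.inr ()) * MvPolynomial.X (Sum.inl r))) :
    1 - ∑ i : Fin n, w i =
      1 + ∑ s ∈ Finset.univ.powerset.filter (fun s : Finset (Fin n) => 2 ≤ s.card),
        ((blockSum (dpaths pre) (s.sort (· ≤ ·)) : ℤ) : MvPolynomial (Fin n ⊕ Unit) ℚ) *
          (MvPolynomial.X (Sum.inr ())) ^ s.card * ∏ i ∈ s, MvPolynomial.X (Sum.inl i) := by
  set y : Fin n → MvPolynomial (Fin n ⊕ Unit) ℚ :=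
    fun i => MvPolynomial.X (Sum.inr ()) * MvPolynomial.X (Sum.inl i) with hy
  have hR : ∀ a b, (fun u v : Fin n => u < v ∧ ¬ pre u v) a b → a < b := fun _ _ h => h.1
  have hd : ∀ L, dpaths pre L = (pathSet (fun u v => u < v ∧ ¬ pre u v) L).ncard :=
    fun _ => rfl
  have huniv : upperFin n 0 = Finset.univ := by simp [upperFin]
  have hsum := (weightedSum_upperFin hR hd y w (fun i => by convert hw i) (Nat.zero_le n)).1
  rw [huniv, weightedSum_blockSum_univ hR hd] at hsum
  rw [← hsum]
  refine congrArg _ (Finset.sum_congr rfl fun s _ => ?_)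
  simp only [hy, Finset.prod_mul_distrib, Finset.prod_const]
  ring
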